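/- There exists a constant c > 0 such that for every positive integer n there is an arrangement of n orthogonal circles in the Euclidean plane whose intersection graph has at least 4n − c·√n edges, i.e. at least 4n − c·√n unordered pairs of circles of the arrangement intersect. -/

import Mathlib

open scoped Classical

/-- A circle in the Euclidean plane, given by a center and a positive radius. -/
structure Circ where
  center : EuclideanSpace ℝ (Fin 2)
  radius : ℝ
  radius_pos : 0 < radius

namespace Circ

/-- The circle as a point set: points at distance exactly `radius` from the center. -/
def points (C : Circ) : Set (EuclideanSpace ℝ (Fin 2)) := Metric.sphere C.center C.radius

/-- The closed disk bounded by the circle. -/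
def closedDisk (C : Circ) : Set (EuclideanSpace ℝ (Fin 2)) := Metric.closedBall C.center C.radius

/-- The open disk bounded by the circle. -/
def openDisk (C : Circ) : Set (EuclideanSpace ℝ (Fin 2)) := Metric.ball C.center C.radius

/-- Two circles intersect if they share a point. -/
def Intersects (A B : Circ) : Prop := (A.points ∩ B.points).Nonempty

/-- Two circles intersect orthogonally. -/
def Orthogonal (A B : Circ) : Prop :=
  Intersects A B ∧ dist A.center B.center ^ 2 = A.radius ^ 2 + B.radius ^ 2

/-- Two circles are nested if the closed disk bounded by one is contained in the
closed disk bounded by the other. -/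
def Nested (A B : Circ) : Prop :=
  A.closedDisk ⊆ B.closedDisk ∨ B.closedDisk ⊆ A.closedDisk

end Circ

open Circ

/-- Number of unordered pairs of circles of `𝒜` that intersect. -/
noncomputable def edgeCount (𝒜 : Finset Circ) : ℕ :=
  ((𝒜.powersetCard 2).filter fun e => ∃ A ∈ e, ∃ B ∈ e, A ≠ B ∧ Intersects A B).card

namespace Circ

theorem dist_sq_eq_coords (p q : EuclideanSpace ℝ (Fin 2)) :
    dist p q ^ 2 = (p 0 - q 0) ^ 2 + (p 1 - q 1) ^ 2 := by
  rw [EuclideanSpace.dist_eq, Real.sq_sqrt (by positivity)]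
  simp [Fin.sum_univ_two, Real.dist_eq, sq_abs]

theorem Intersects.symm {A B : Circ} (h : Intersects A B) : Intersects B A := by
  rwa [Intersects, Set.inter_comm]

theorem Intersects.refl (A : Circ) : Intersects A A := by
  rw [Intersects, Set.inter_self]
  exact NormedSpace.sphere_nonempty.2 A.radius_pos.le

theorem Intersects.dist_sq_le {A B : Circ} (h : Intersects A B) :
    dist A.center B.center ^ 2 ≤ (A.radius + B.radius) ^ 2 := by
  obtain ⟨p, hA, hB⟩ := h
  have hA : dist p A.center = A.radius := hA
  have hB : dist p B.center = B.radius := hB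
  have := dist_triangle_left A.center B.center p
  rw [hA, hB] at this
  gcongr

/-- Circles satisfying the orthogonality relation between distance and radii do meet. -/
theorem intersects_of_dist_sq_eq {A B : Circ}
    (h : dist A.center B.center ^ 2 = A.radius ^ 2 + B.radius ^ 2) : Intersects A B := by
  have hr := A.radius_pos
  have hs := B.radius_pos
  rw [dist_sq_eq_coords] at h
  generalize hA : A.radius = r at *
  generalize hB : B.radius = s at *
  generalize hu : A.center 0 = a at *
  generalize hv : A.center 1 = b at *
  generalize hw : B.center 0 = c at *
  generalize hz : B.center 1 = d at *
  have hD : 0 < r ^ 2 + s ^ 2 := by positivity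
  refine ⟨!₂[a + (r ^ 2 * (c - a) - r * s * (d - b)) / (r ^ 2 + s ^ 2),
    b + (r ^ 2 * (d - b) + r * s * (c - a)) / (r ^ 2 + s ^ 2)], ?_, ?_⟩
  · change dist _ _ = _
    rw [← sq_eq_sq₀ dist_nonneg (by rw [hA]; exact hr.le), dist_sq_eq_coords]
    simp only [hA, hu, hv, Matrix.cons_val_zero, Matrix.cons_val_one]
    field_simp
    linear_combination (r ^ 2 * (r ^ 2 + s ^ 2)) * h
  · change dist _ _ = _
    rw [← sq_eq_sq₀ dist_nonneg (by rw [hB]; exact hs.le), dist_sq_eq_coords]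
    simp only [hB, hw, hz, Matrix.cons_val_zero, Matrix.cons_val_one]
    field_simp
    linear_combination (s ^ 2 * (r ^ 2 + s ^ 2)) * h

end Circ

theorem edgeCount_mono {𝒜 ℬ : Finset Circ} (h : 𝒜 ⊆ ℬ) : edgeCount 𝒜 ≤ edgeCount ℬ :=
  Finset.card_le_card (Finset.filter_subset_filter _ (Finset.powersetCard_mono h))

/-- The arrangement can be enlarged by a circle that meets none of its circles. -/
theorem exists_circ_disjoint (𝒜 : Finset Circ) :
    ∃ C : Circ, ∀ A ∈ 𝒜, ¬ Intersects A C := by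
  have hb : Bornology.IsBounded (⋃ A ∈ 𝒜, A.points) :=
    (Bornology.isBounded_biUnion_finset 𝒜).2 fun A _ => Metric.isBounded_sphere
  obtain ⟨R, hR⟩ := hb.subset_closedBall 0
  refine ⟨⟨0, max R 0 + 1, by positivity⟩, ?_⟩
  rintro A hA ⟨p, hpA, hp⟩
  have h1 : dist p 0 ≤ R := hR (Set.mem_biUnion hA hpA)
  have h2 : dist p 0 = max R 0 + 1 := hp
  have := le_max_left R 0
  linarith

theorem exists_padding (𝒜 : Finset Circ)
    (h : (𝒜 : Set Circ).Pairwise fun X Y => Intersects X Y → Orthogonal X Y) (k : ℕ) :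
    ∃ ℬ : Finset Circ, ℬ.card = 𝒜.card + k ∧
      ((ℬ : Set Circ).Pairwise fun X Y => Intersects X Y → Orthogonal X Y) ∧ 𝒜 ⊆ ℬ := by
  induction k with
  | zero => exact ⟨𝒜, rfl, h, subset_rfl⟩
  | succ k ih =>
    obtain ⟨ℬ, hc, hp, hs⟩ := ih
    obtain ⟨C, hC⟩ := exists_circ_disjoint ℬ
    have hCB : C ∉ ℬ := fun hmem => hC C hmem (Circ.Intersects.refl C)
    refine ⟨insert C ℬ, ?_, ?_, hs.trans (Finset.subset_insert _ _)⟩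
    · rw [Finset.card_insert_of_notMem hCB, hc, add_assoc]
    · rw [Finset.coe_insert]
      refine hp.insert fun B hB _ => ⟨fun hi => ?_, fun hi => ?_⟩
      · exact (hC B hB hi.symm).elim
      · exact (hC B hB hi).elim

/-- The parameters of an arrangement of concentric rings of circles: neighbouring circles of a ring
are seen from the origin at angle `2 * θ`, and consecutive rings are related by the similarity with
angle `θ` and ratio `lam`. -/
structure RingParams (m : ℕ) where
  θ : ℝ
  lam : ℝ
  θ_pos : 0 < θ
  θ_mul : θ * (4 * m + 4) = 1
  one_lt_lam : 1 < lam
  lam_eq : Real.cos (2 * θ) * (lam ^ 2 + 1) = 2 * Real.cos θ * lam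

theorem cos_bounds {θ : ℝ} (h0 : 0 < θ) (h1 : θ ≤ 1 / 4) :
    31 / 32 ≤ Real.cos θ ∧ Real.cos θ < 1 := by
  constructor
  · nlinarith [Real.one_sub_sq_div_two_le_cos (x := θ)]
  · have := Real.sin_pos_of_pos_of_lt_pi h0 (by linarith [Real.pi_gt_three])
    nlinarith [Real.sin_sq_add_cos_sq θ]

theorem exists_ringParams (m : ℕ) : Nonempty (RingParams m) := by
  have hm : (0 : ℝ) ≤ m := m.cast_nonneg
  have h0 : (0 : ℝ) < 1 / (4 * m + 4) := by positivity
  have h1 : (1 : ℝ) / (4 * m + 4) ≤ 1 / 4 := by gcongr; linarith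
  obtain ⟨hx0, hx1⟩ := cos_bounds h0 h1
  have hmul : (1 : ℝ) / (4 * m + 4) * (4 * m + 4) = 1 := by field_simp
  generalize (1 : ℝ) / (4 * m + 4) = θ at *
  have hc : Real.cos (2 * θ) = 2 * Real.cos θ ^ 2 - 1 := Real.cos_two_mul θ
  have hcpos : 0 < Real.cos (2 * θ) := by nlinarith
  have hcx : Real.cos (2 * θ) < Real.cos θ := by nlinarith
  have hs := Real.sq_sqrt (show 0 ≤ Real.cos θ ^ 2 - Real.cos (2 * θ) ^ 2 by nlinarith)
  refine ⟨⟨θ, (Real.cos θ + √(Real.cos θ ^ 2 - Real.cos (2 * θ) ^ 2)) / Real.cos (2 * θ), h0, hmul,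
    ?_, ?_⟩⟩
  · rw [lt_div_iff₀ hcpos]
    linarith [Real.sqrt_nonneg (Real.cos θ ^ 2 - Real.cos (2 * θ) ^ 2)]
  · generalize √(Real.cos θ ^ 2 - Real.cos (2 * θ) ^ 2) = w at *
    field_simp
    linear_combination hs

namespace RingParams

variable {m : ℕ} (P : RingParams m)

theorem θ_le : P.θ ≤ 1 / 4 := by
  have h := P.θ_mul
  have hm : (0 : ℝ) ≤ m := m.cast_nonneg
  nlinarith [P.θ_pos]

theorem le_cos : 31 / 32 ≤ Real.cos P.θ := (cos_bounds P.θ_pos P.θ_le).1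

theorem cos_lt : Real.cos P.θ < 1 := (cos_bounds P.θ_pos P.θ_le).2

theorem cos_two_pos : 0 < Real.cos (2 * P.θ) := by
  rw [Real.cos_two_mul]; nlinarith [P.le_cos]

theorem cos_two_lt : Real.cos (2 * P.θ) < Real.cos P.θ ^ 2 := by
  rw [Real.cos_two_mul]; nlinarith [P.le_cos, P.cos_lt]

theorem cos_two_lt_one : Real.cos (2 * P.θ) < 1 := by
  nlinarith [P.le_cos, P.cos_lt, P.cos_two_lt]

theorem lam_pos : 0 < P.lam := one_pos.trans P.one_lt_lam

/-- The circles of the arrangement: `Sum.inl (i, j)` is the `j`-th circle of the `i`-th ring and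
`Sum.inr i` is the circle about the origin orthogonal to the `i`-th ring. -/
noncomputable def circ : ℕ × ℕ ⊕ ℕ → Circ
  | .inl (i, j) =>
    { center := !₂[P.lam ^ i * Real.cos ((i + 2 * j) * P.θ), P.lam ^ i * Real.sin ((i + 2 * j) * P.θ)]
      radius := P.lam ^ i * √(1 - Real.cos (2 * P.θ))
      radius_pos := mul_pos (pow_pos P.lam_pos i) (Real.sqrt_pos.2 (sub_pos.2 P.cos_two_lt_one)) }
  | .inr i =>
    { center := 0
      radius := P.lam ^ i * √(Real.cos (2 * P.θ))
      radius_pos := mul_pos (pow_pos P.lam_pos i) (Real.sqrt_pos.2 P.cos_two_pos) }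

theorem sq_radius_inl (i j : ℕ) :
    (P.circ (.inl (i, j))).radius ^ 2 = (P.lam ^ i) ^ 2 * (1 - Real.cos (2 * P.θ)) := by
  simp only [circ]
  rw [mul_pow, Real.sq_sqrt (sub_pos.2 P.cos_two_lt_one).le]

theorem sq_radius_inr (i : ℕ) :
    (P.circ (.inr i)).radius ^ 2 = (P.lam ^ i) ^ 2 * Real.cos (2 * P.θ) := by
  simp only [circ]
  rw [mul_pow, Real.sq_sqrt P.cos_two_pos.le]

theorem dist_sq_inl_inl (i j a j' : ℕ) :
    dist (P.circ (.inl (i, j))).center (P.circ (.inl (i + a, j'))).center ^ 2 =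
      (P.lam ^ i) ^ 2 * (1 + (P.lam ^ a) ^ 2
        - 2 * P.lam ^ a * Real.cos (((a + 2 * j' - 2 * j : ℤ) : ℝ) * P.θ)) := by
  have hcos : Real.cos (((a + 2 * j' - 2 * j : ℤ) : ℝ) * P.θ) =
      Real.cos ((((i + a : ℕ) : ℝ) + 2 * j') * P.θ) * Real.cos ((i + 2 * j) * P.θ) +
      Real.sin ((((i + a : ℕ) : ℝ) + 2 * j') * P.θ) * Real.sin ((i + 2 * j) * P.θ) := by
    rw [← Real.cos_sub]; congr 1; push_cast; ring
  rw [Circ.dist_sq_eq_coords, hcos]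
  simp only [circ, Matrix.cons_val_zero, Matrix.cons_val_one]
  have h1 := Real.sin_sq_add_cos_sq ((((i + a : ℕ) : ℝ) + 2 * j') * P.θ)
  have h2 := Real.sin_sq_add_cos_sq ((i + 2 * j) * P.θ)
  rw [pow_add]
  linear_combination (P.lam ^ i * P.lam ^ a) ^ 2 * h1 + (P.lam ^ i) ^ 2 * h2

theorem dist_sq_inl_inr (i j i' : ℕ) :
    dist (P.circ (.inl (i, j))).center (P.circ (.inr i')).center ^ 2 = (P.lam ^ i) ^ 2 := by
  rw [Circ.dist_sq_eq_coords]
  simp only [circ, Matrix.cons_val_zero, Matrix.cons_val_one, PiLp.zero_apply, sub_zero]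
  linear_combination (P.lam ^ i) ^ 2 * Real.sin_sq_add_cos_sq ((i + 2 * j) * P.θ)

theorem dist_sq_eq_of_same_ring {i j j' : ℕ} (hb : |(2 * j' - 2 * j : ℤ)| = 2) :
    dist (P.circ (.inl (i, j))).center (P.circ (.inl (i, j'))).center ^ 2 =
      (P.circ (.inl (i, j))).radius ^ 2 + (P.circ (.inl (i, j'))).radius ^ 2 := by
  have h := P.dist_sq_inl_inl i j 0 j'
  rw [add_zero] at h
  rw [h, sq_radius_inl, sq_radius_inl]
  have : Real.cos ((((0 : ℕ) + 2 * j' - 2 * j : ℤ) : ℝ) * P.θ) = Real.cos (2 * P.θ) := by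
    rw [← Real.cos_abs, abs_mul, abs_of_pos P.θ_pos, ← Int.cast_abs]
    simp [hb]
  rw [this]; ring

theorem dist_sq_eq_of_consecutive_ring {i j j' : ℕ} (hb : |(1 + 2 * j' - 2 * j : ℤ)| = 1) :
    dist (P.circ (.inl (i, j))).center (P.circ (.inl (i + 1, j'))).center ^ 2 =
      (P.circ (.inl (i, j))).radius ^ 2 + (P.circ (.inl (i + 1, j'))).radius ^ 2 := by
  rw [P.dist_sq_inl_inl, sq_radius_inl, sq_radius_inl]
  have : Real.cos ((((1 : ℕ) + 2 * j' - 2 * j : ℤ) : ℝ) * P.θ) = Real.cos P.θ := by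
    rw [← Real.cos_abs, abs_mul, abs_of_pos P.θ_pos, ← Int.cast_abs]
    simp [hb]
  rw [this]
  linear_combination (P.lam ^ i) ^ 2 * P.lam_eq

theorem dist_sq_eq_inl_inr (i j : ℕ) :
    dist (P.circ (.inl (i, j))).center (P.circ (.inr i)).center ^ 2 =
      (P.circ (.inl (i, j))).radius ^ 2 + (P.circ (.inr i)).radius ^ 2 := by
  rw [P.dist_sq_inl_inr, sq_radius_inl, sq_radius_inr]; ring

theorem cos_mul_le {b : ℤ} (k : ℕ) (hk : (k : ℤ) ≤ |b|) (hb : |b| ≤ 4 * m + 4) :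
    Real.cos (b * P.θ) ≤ Real.cos (k * P.θ) := by
  have h1 : (k : ℝ) ≤ |(b : ℝ)| := by exact_mod_cast hk
  have h2 : |(b : ℝ)| ≤ 4 * m + 4 := by exact_mod_cast hb
  rw [← Real.cos_abs (b * P.θ), abs_mul, abs_of_pos P.θ_pos]
  refine Real.cos_le_cos_of_nonneg_of_le_pi (by have := P.θ_pos; positivity) ?_ ?_
  · nlinarith [P.θ_pos, P.θ_mul, Real.pi_gt_three]
  · exact mul_le_mul_of_nonneg_right h1 P.θ_pos.le

theorem sq_add_one_mul_le {a : ℕ} {k : ℕ} (h : k ≤ a) :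
    P.lam ^ a * ((P.lam ^ k) ^ 2 + 1) ≤ P.lam ^ k * ((P.lam ^ a) ^ 2 + 1) := by
  have h1 : P.lam ^ k ≤ P.lam ^ a := pow_le_pow_right₀ P.one_lt_lam.le h
  have h2 : 1 ≤ P.lam ^ k := one_le_pow₀ P.one_lt_lam.le
  nlinarith [mul_nonneg (sub_nonneg.2 h1)
    (sub_nonneg.2 (one_le_mul_of_one_le_of_one_le h2 (h2.trans h1)))]

/-- Circles of two rings that meet are equal or adjacent. -/
theorem eq_or_orthogonal_inl_inl {i j a j' : ℕ} (hi : i + a < m) (hj : j < m) (hj' : j' < m)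
    (h : Intersects (P.circ (.inl (i, j))) (P.circ (.inl (i + a, j')))) :
    (a = 0 ∧ j = j') ∨
      dist (P.circ (.inl (i, j))).center (P.circ (.inl (i + a, j'))).center ^ 2 =
      (P.circ (.inl (i, j))).radius ^ 2 + (P.circ (.inl (i + a, j'))).radius ^ 2 := by
  have hle := h.dist_sq_le
  have hL : 0 < (P.lam ^ i) ^ 2 := pow_pos (pow_pos P.lam_pos i) 2
  have hr : ((P.circ (.inl (i, j))).radius + (P.circ (.inl (i + a, j'))).radius) ^ 2 =
      (P.lam ^ i) ^ 2 * ((1 - Real.cos (2 * P.θ)) * (1 + P.lam ^ a) ^ 2) := by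
    have hs := Real.sq_sqrt (sub_pos.2 P.cos_two_lt_one).le
    simp only [circ]
    rw [pow_add]
    linear_combination (P.lam ^ i * (1 + P.lam ^ a)) ^ 2 * hs
  rw [hr, P.dist_sq_inl_inl] at hle
  replace hle := le_of_mul_le_mul_left hle hL
  have hx0 := P.le_cos
  have hx1 := P.cos_lt
  have hc0 := P.cos_two_pos
  have hc1 := P.cos_two_lt
  have hc2 := P.cos_two_lt_one
  have hc := Real.cos_two_mul P.θ
  have hlam := P.lam_eq
  have hlp := P.lam_pos
  match a with
  | 0 =>
    by_cases hjj : j = j'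
    · exact .inl ⟨rfl, hjj⟩
    right
    by_cases hb : |(2 * j' - 2 * j : ℤ)| = 2
    · exact P.dist_sq_eq_of_same_ring hb
    exfalso
    have := P.cos_mul_le (b := ((0 : ℕ) + 2 * j' - 2 * j : ℤ)) 4
      (by push_cast; rw [Int.abs_eq_natAbs] at hb ⊢; omega)
      (by push_cast; rw [Int.abs_eq_natAbs]; omega)
    have h4 : Real.cos ((4 : ℕ) * P.θ) = 2 * Real.cos (2 * P.θ) ^ 2 - 1 := by
      rw [← Real.cos_two_mul]; congr 1; push_cast; ring
    rw [h4] at this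
    rw [pow_zero] at hle
    nlinarith
  | 1 =>
    right
    by_cases hb : |(1 + 2 * j' - 2 * j : ℤ)| = 1
    · exact P.dist_sq_eq_of_consecutive_ring hb
    exfalso
    have := P.cos_mul_le (b := ((1 : ℕ) + 2 * j' - 2 * j : ℤ)) 3
      (by push_cast; rw [Int.abs_eq_natAbs] at hb ⊢; omega)
      (by push_cast; rw [Int.abs_eq_natAbs]; omega)
    have h3 : Real.cos ((3 : ℕ) * P.θ) = 4 * Real.cos P.θ ^ 3 - 3 * Real.cos P.θ := by
      rw [← Real.cos_three_mul]; congr 1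
    rw [h3] at this
    rw [pow_one] at hle
    generalize Real.cos (((1 : ℕ) + 2 * j' - 2 * j : ℤ) * P.θ) = y at *
    generalize Real.cos P.θ = x at *
    generalize Real.cos (2 * P.θ) = c at *
    have h5 : P.lam * (2 * x) ≤ P.lam * (2 * (y + 1 - c)) := by nlinarith
    have h6 := le_of_mul_le_mul_left h5 hlp
    nlinarith [mul_pos (mul_pos (sub_pos.2 hx1) (show 0 < 1 + x by linarith))
      (show 0 < 2 * x - 1 by linarith)]
  | a + 2 =>
    exfalso
    have hmono := P.sq_add_one_mul_le (show 2 ≤ a + 2 by omega)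
    have hmu : 0 < P.lam ^ (a + 2) := pow_pos hlp _
    have hy := Real.cos_le_one ((((a + 2 : ℕ) : ℤ) + 2 * j' - 2 * j : ℤ) * P.θ)
    generalize Real.cos ((((a + 2 : ℕ) : ℤ) + 2 * j' - 2 * j : ℤ) * P.θ) = y at *
    generalize P.lam ^ (a + 2) = μ at *
    generalize Real.cos P.θ = x at *
    generalize Real.cos (2 * P.θ) = c at *
    generalize P.lam = l at *
    have h1 : c * (μ ^ 2 + 1) ≤ μ * (4 - 2 * c) := by nlinarith
    have h2 : μ * (c * ((l ^ 2) ^ 2 + 1)) ≤ μ * (l ^ 2 * (4 - 2 * c)) := by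
      nlinarith [mul_le_mul_of_nonneg_left h1 (sq_nonneg l), mul_le_mul_of_nonneg_left hmono hc0.le]
    have h3 := le_of_mul_le_mul_left h2 hmu
    have h4 : l ^ 2 * (4 * x ^ 2) ≤ l ^ 2 * (4 * c) := by
      have h5 : (c * (l ^ 2 + 1)) ^ 2 = (2 * x * l) ^ 2 := by rw [hlam]
      nlinarith [mul_le_mul_of_nonneg_left h3 hc0.le]
    have h6 := le_of_mul_le_mul_left h4 (pow_pos hlp 2)
    linarith

theorem four_mul_lt {i i' : ℕ} (h : i < i') :
    4 * ((P.lam ^ i) ^ 2 * (P.lam ^ i') ^ 2) <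
      Real.cos (2 * P.θ) * ((P.lam ^ i) ^ 2 + (P.lam ^ i') ^ 2) ^ 2 := by
  obtain ⟨a, rfl⟩ := Nat.exists_eq_add_of_lt h
  have hmono := P.sq_add_one_mul_le (show 1 ≤ a + 1 by omega)
  have hL : 0 < (P.lam ^ i) ^ 4 := pow_pos (pow_pos P.lam_pos i) 4
  have hmu : 0 < P.lam ^ (a + 1) := pow_pos P.lam_pos _
  have hx0 := P.le_cos
  have hc0 := P.cos_two_pos
  have hc1 := P.cos_two_lt
  have hlam := P.lam_eq
  have hlp := P.lam_pos
  rw [pow_one] at hmono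
  rw [add_assoc, pow_add]
  generalize P.lam ^ (a + 1) = μ at *
  generalize P.lam ^ i = L at *
  generalize Real.cos P.θ = x at *
  generalize Real.cos (2 * P.θ) = c at *
  generalize P.lam = l at *
  have h1 : l * (2 * x * μ) ≤ l * (c * (μ ^ 2 + 1)) := by
    nlinarith [mul_le_mul_of_nonneg_left hmono hc0.le]
  have h2 := pow_le_pow_left₀ (by positivity) (le_of_mul_le_mul_left h1 hlp) 2
  have h3 : c * (4 * μ ^ 2) < c * (c * (μ ^ 2 + 1) ^ 2) := by
    nlinarith [mul_lt_mul_of_pos_right hc1 (pow_pos hmu 2)]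
  have h4 := mul_lt_mul_of_pos_left (lt_of_mul_lt_mul_left h3 hc0.le) hL
  nlinarith

/-- A ring circle meeting a circle about the origin belongs to the corresponding ring. -/
theorem eq_of_intersects_inl_inr {i j i' : ℕ}
    (h : Intersects (P.circ (.inl (i, j))) (P.circ (.inr i'))) : i = i' := by
  obtain ⟨p, hA, hB⟩ := h
  have hA : dist p (P.circ (.inl (i, j))).center = (P.circ (.inl (i, j))).radius := hA
  have hB : dist p (P.circ (.inr i')).center = (P.circ (.inr i')).radius := hB
  have h0 : 0 < P.lam ^ i := pow_pos P.lam_pos i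
  have hd : dist (P.circ (.inl (i, j))).center (P.circ (.inr i')).center = P.lam ^ i :=
    (sq_eq_sq₀ dist_nonneg h0.le).1 (P.dist_sq_inl_inr i j i')
  have h1 := dist_triangle p (P.circ (.inl (i, j))).center (P.circ (.inr i')).center
  have h2 := dist_triangle_left (P.circ (.inl (i, j))).center (P.circ (.inr i')).center p
  rw [hA, hB, hd] at h1 h2
  have hr := P.sq_radius_inl i j
  have hs := P.sq_radius_inr i'
  have hs0 := (P.circ (.inr i')).radius_pos
  have hc0 := P.cos_two_pos
  generalize (P.circ (.inl (i, j))).radius = r at *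
  generalize (P.circ (.inr i')).radius = s at *
  have hsq := sq_le_sq' (show -r ≤ s - P.lam ^ i by linarith) (by linarith)
  have hle : Real.cos (2 * P.θ) * ((P.lam ^ i) ^ 2 + (P.lam ^ i') ^ 2) ≤ 2 * (P.lam ^ i * s) := by
    linarith
  have hle' := pow_le_pow_left₀ (by positivity) hle 2
  have hfin : Real.cos (2 * P.θ) * (Real.cos (2 * P.θ) * ((P.lam ^ i) ^ 2 + (P.lam ^ i') ^ 2) ^ 2) ≤
      Real.cos (2 * P.θ) * (4 * ((P.lam ^ i) ^ 2 * (P.lam ^ i') ^ 2)) := by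
    linear_combination hle' + 4 * (P.lam ^ i) ^ 2 * hs
  replace hfin := le_of_mul_le_mul_left hfin hc0
  rcases lt_trichotomy i i' with hlt | heq | hgt
  · linarith [P.four_mul_lt hlt]
  · exact heq
  · linarith [P.four_mul_lt hgt]

theorem eq_of_intersects_inr_inr {i i' : ℕ}
    (h : Intersects (P.circ (.inr i)) (P.circ (.inr i'))) : i = i' := by
  obtain ⟨p, hA, hB⟩ := h
  have hAB : P.lam ^ i * √(Real.cos (2 * P.θ)) = P.lam ^ i' * √(Real.cos (2 * P.θ)) :=
    hA.symm.trans hB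
  exact pow_right_injective₀ P.lam_pos P.one_lt_lam.ne'
    (mul_right_cancel₀ (Real.sqrt_pos.2 P.cos_two_pos).ne' hAB)

/-- The indices of the circles used in the arrangement. -/
def index (m : ℕ) : Finset (ℕ × ℕ ⊕ ℕ) :=
  (Finset.range m ×ˢ Finset.range m).disjSum (Finset.range m)

theorem eq_or_orthogonal {u v : ℕ × ℕ ⊕ ℕ} (hu : u ∈ index m) (hv : v ∈ index m)
    (h : Intersects (P.circ u) (P.circ v)) :
    u = v ∨ dist (P.circ u).center (P.circ v).center ^ 2 =
      (P.circ u).radius ^ 2 + (P.circ v).radius ^ 2 := by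
  match u, v with
  | .inl (i, j), .inl (i', j') =>
    simp only [index, Finset.inl_mem_disjSum, Finset.mem_product, Finset.mem_range] at hu hv
    rcases le_total i i' with hi | hi
    · obtain ⟨a, rfl⟩ := Nat.exists_eq_add_of_le hi
      refine (P.eq_or_orthogonal_inl_inl hv.1 hu.2 hv.2 h).imp_left ?_
      rintro ⟨rfl, rfl⟩
      rfl
    · obtain ⟨a, rfl⟩ := Nat.exists_eq_add_of_le hi
      rw [dist_comm, add_comm (Circ.radius _ ^ 2)]
      refine (P.eq_or_orthogonal_inl_inl hu.1 hv.2 hu.2 h.symm).imp_left ?_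
      rintro ⟨rfl, rfl⟩
      rfl
  | .inl (i, j), .inr i' =>
    obtain rfl := P.eq_of_intersects_inl_inr h
    exact .inr (P.dist_sq_eq_inl_inr i j)
  | .inr i', .inl (i, j) =>
    obtain rfl := P.eq_of_intersects_inl_inr h.symm
    rw [dist_comm, add_comm (Circ.radius _ ^ 2)]
    exact .inr (P.dist_sq_eq_inl_inr i j)
  | .inr i, .inr i' => exact .inl (congrArg _ (P.eq_of_intersects_inr_inr h))

theorem circ_injOn : Set.InjOn P.circ (index m) := by
  intro u hu v hv huv
  refine (P.eq_or_orthogonal hu hv (huv ▸ Circ.Intersects.refl _)).resolve_right fun h => ?_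
  rw [huv, dist_self] at h
  have := (P.circ v).radius_pos
  nlinarith

end RingParams

/-- Four families of edges of the arrangement: within a ring, between a ring and its circle about
the origin, and between consecutive rings. -/
def ringEdge : (ℕ × ℕ) × Fin 4 → (ℕ × ℕ ⊕ ℕ) × (ℕ × ℕ ⊕ ℕ)
  | ((i, j), 0) => (.inl (i, j), .inl (i, j + 1))
  | ((i, j), 1) => (.inl (i, j), .inr i)
  | ((i, j), 2) => (.inl (i, j), .inl (i + 1, j))
  | ((i, j), 3) => (.inl (i, j + 1), .inl (i + 1, j))

theorem eq_of_ringEdge_eq_or_swap {e f : (ℕ × ℕ) × Fin 4}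
    (h : ringEdge e = ringEdge f ∨ ringEdge e = (ringEdge f).swap) : e = f := by
  obtain ⟨⟨i, j⟩, s⟩ := e
  obtain ⟨⟨k, l⟩, t⟩ := f
  fin_cases s <;> fin_cases t <;> simp [ringEdge] at h ⊢ <;> omega

namespace RingParams

variable {m : ℕ} (P : RingParams m)

theorem ringEdge_intersects (e : (ℕ × ℕ) × Fin 4) :
    Intersects (P.circ (ringEdge e).1) (P.circ (ringEdge e).2) := by
  obtain ⟨⟨i, j⟩, s⟩ := e
  apply Circ.intersects_of_dist_sq_eq
  match s with
  | 0 => exact P.dist_sq_eq_of_same_ring (by push_cast; ring_nf; rfl)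
  | 1 => exact P.dist_sq_eq_inl_inr i j
  | 2 => exact P.dist_sq_eq_of_consecutive_ring (by ring_nf; rfl)
  | 3 => exact P.dist_sq_eq_of_consecutive_ring (by push_cast; ring_nf; rfl)

theorem ringEdge_mem {e : (ℕ × ℕ) × Fin 4}
    (he : e ∈ (Finset.range (m - 1) ×ˢ Finset.range (m - 1)) ×ˢ (Finset.univ : Finset (Fin 4))) :
    (ringEdge e).1 ∈ index m ∧ (ringEdge e).2 ∈ index m := by
  obtain ⟨⟨i, j⟩, s⟩ := e
  simp only [Finset.mem_product, Finset.mem_range, Finset.mem_univ, and_true] at he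
  fin_cases s <;> simp [ringEdge, index] <;> omega

theorem ringEdge_ne (e : (ℕ × ℕ) × Fin 4) : (ringEdge e).1 ≠ (ringEdge e).2 := by
  obtain ⟨⟨i, j⟩, s⟩ := e
  fin_cases s <;> simp [ringEdge]

theorem le_edgeCount : 4 * (m - 1) ^ 2 ≤ edgeCount ((index m).image P.circ) := by
  have hcard : ((Finset.range (m - 1) ×ˢ Finset.range (m - 1)) ×ˢ
      (Finset.univ : Finset (Fin 4))).card = 4 * (m - 1) ^ 2 := by
    simp only [Finset.card_product, Finset.card_range, Finset.card_univ, Fintype.card_fin]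
    ring
  rw [← hcard]
  refine Finset.card_le_card_of_injOn
    (fun e => {P.circ (ringEdge e).1, P.circ (ringEdge e).2}) ?_ ?_
  · intro e he
    obtain ⟨h1, h2⟩ := ringEdge_mem he
    have hne : P.circ (ringEdge e).1 ≠ P.circ (ringEdge e).2 :=
      fun h => ringEdge_ne e (P.circ_injOn h1 h2 h)
    simp only [Finset.coe_filter, Set.mem_ofPred_eq, Finset.mem_powersetCard]
    refine ⟨⟨?_, Finset.card_pair hne⟩, _, Finset.mem_insert_self _ _, _,
      Finset.mem_insert_of_mem (Finset.mem_singleton_self _), hne, P.ringEdge_intersects e⟩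
    simp only [Finset.insert_subset_iff, Finset.singleton_subset_iff]
    exact ⟨Finset.mem_image_of_mem _ h1, Finset.mem_image_of_mem _ h2⟩
  · intro e he f hf hef
    obtain ⟨h1, h2⟩ := ringEdge_mem he
    obtain ⟨h3, h4⟩ := ringEdge_mem hf
    have hset := congrArg (fun s : Finset Circ => (s : Set Circ)) hef
    simp only [Finset.coe_pair, Set.pair_eq_pair_iff] at hset
    refine eq_of_ringEdge_eq_or_swap (hset.imp ?_ ?_)
    · exact fun h => Prod.ext (P.circ_injOn h1 h3 h.1) (P.circ_injOn h2 h4 h.2)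
    · exact fun h => Prod.ext (P.circ_injOn h1 h4 h.1) (P.circ_injOn h2 h3 h.2)

theorem card_image : ((index m).image P.circ).card = m * m + m := by
  rw [Finset.card_image_of_injOn P.circ_injOn]
  simp [index]

theorem pairwise_image : (((index m).image P.circ : Finset Circ) : Set Circ).Pairwise
    fun X Y => Intersects X Y → Orthogonal X Y := by
  intro X hX Y hY hne h
  simp only [Finset.coe_image, Set.mem_image, Finset.mem_coe] at hX hY
  obtain ⟨u, hu, rfl⟩ := hX
  obtain ⟨v, hv, rfl⟩ := hY
  exact ⟨h, (P.eq_or_orthogonal hu hv h).resolve_left fun huv => hne (huv ▸ rfl)⟩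

end RingParams

theorem stmt16 : ∃ c : ℝ, 0 < c ∧ ∀ n : ℕ, 0 < n → ∃ 𝒜 : Finset Circ,
    𝒜.card = n ∧
    ((𝒜 : Set Circ).Pairwise fun X Y => Intersects X Y → Orthogonal X Y) ∧
    4 * (n : ℝ) - c * Real.sqrt n ≤ (edgeCount 𝒜 : ℝ) := by
  refine ⟨24, by norm_num, fun n hn => ?_⟩
  obtain ⟨m, hm⟩ := Nat.exists_eq_succ_of_ne_zero (Nat.sqrt_pos.2 hn).ne'
  have h1 := Nat.sqrt_le n
  have h2 := Nat.sqrt_le_add n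
  rw [hm] at h1 h2
  have hs : ((m + 1 : ℕ) : ℝ) ≤ √n := by
    rw [← Nat.succ_eq_add_one, ← hm]
    exact Real.nat_sqrt_le_real_sqrt
  obtain ⟨P⟩ := exists_ringParams m
  obtain ⟨ℬ, hcard, hpair, hsub⟩ := exists_padding _ P.pairwise_image (n - (m * m + m))
  refine ⟨ℬ, ?_, hpair, ?_⟩
  · rw [hcard, P.card_image]
    exact Nat.add_sub_cancel' (by nlinarith)
  have hedge : 4 * n ≤ edgeCount ℬ + 24 * (m + 1) := by
    have := P.le_edgeCount.trans (edgeCount_mono hsub)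
    rcases m with _ | q
    · omega
    · rw [Nat.add_sub_cancel] at this
      simp only [Nat.succ_eq_add_one] at h2
      nlinarith
  have hedge' : 4 * (n : ℝ) ≤ edgeCount ℬ + 24 * ((m + 1 : ℕ) : ℝ) := by exact_mod_cast hedge
  linarith
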